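/- arXiv:1301.4461 — 5 statements merged into one kernel-verified Lean document; each statement's English description precedes it below -/
import Mathlib

section
/- Let H be a complex inner product space, let U : H → H be a linear isometric involution that is self-adjoint (U² = id and ⟪U x, y⟫ = ⟪x, U y⟫ for all x, y), and let β₁, …, βₙ be an orthonormal family in H. Define S := id − 2·∑ᵢ |βᵢ⟩⟨βᵢ| (the reflection x ↦ x − 2∑ᵢ ⟪βᵢ, x⟫ βᵢ) and Q := −S ∘ U. Let C be the n×n complex matrix with entries C_{ij} = ⟪βᵢ, U βⱼ⟫, and for each integer m ≥ 0 let R⁽ᵐ⁾ := U_{m−1}(C), the Chebyshev polynomial of the second kind of index m−1 evaluated at the matrix C (so R⁽⁰⁾ = 0, R⁽¹⁾ = I). Then for every natural number m and every index i, Qᵐ(βᵢ) = ∑ⱼ ( R⁽ᵐ⁺¹⁾_{ji} • βⱼ − R⁽ᵐ⁾_{ji} • U(βⱼ) ). -/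
open scoped InnerProductSpace ComplexConjugate

theorem aeval_chebyshev_U_add_one {A : Type*} [Ring A] [Algebra ℂ A] (a : A) (m : ℤ) :
    Polynomial.aeval a (Polynomial.Chebyshev.U ℂ (m + 1)) =
      (2 : ℂ) • (a * Polynomial.aeval a (Polynomial.Chebyshev.U ℂ m)) -
        Polynomial.aeval a (Polynomial.Chebyshev.U ℂ (m - 1)) := by
  rw [Polynomial.Chebyshev.U_add_one, mul_assoc]
  simp [two_mul, two_smul]

/-- If the initial state is one of the orthonormal vectors `β i`, then after
`m` iterations of `Q = -S ∘ U` (where `S` is the reflection about the span of the `β i` and `U`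
is a self-adjoint isometric involution), the final state is
`∑ j, (R (m+1))_{ji} • β j - (R m)_{ji} • U (β j)`, where `R m = U_{m-1}(C)` is the Chebyshev
polynomial of the second kind of index `m-1` evaluated at the cosine matrix
`C_{ij} = ⟪β i, U (β j)⟫`. -/
theorem generalized_grover_iteration
    {H : Type*} [NormedAddCommGroup H] [InnerProductSpace ℂ H]
    {n : ℕ} (β : Fin n → H) (hβ : Orthonormal ℂ β)
    (U : H →ₗ[ℂ] H)
    (hU_invol : ∀ x, U (U x) = x)
    (hU_isom : ∀ x y, ⟪U x, U y⟫_ℂ = ⟪x, y⟫_ℂ)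
    (hU_sa : ∀ x y, ⟪U x, y⟫_ℂ = ⟪x, U y⟫_ℂ)
    (S : H →ₗ[ℂ] H)
    (hS : ∀ x, S x = x - (2 : ℂ) • ∑ i, ⟪β i, x⟫_ℂ • β i)
    (Q : H →ₗ[ℂ] H) (hQ : Q = -(S ∘ₗ U))
    (C : Matrix (Fin n) (Fin n) ℂ) (hC : ∀ i j, C i j = ⟪β i, U (β j)⟫_ℂ)
    (R : ℕ → Matrix (Fin n) (Fin n) ℂ)
    (hR : ∀ m : ℕ, R m = Polynomial.aeval C (Polynomial.Chebyshev.U ℂ ((m : ℤ) - 1))) :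
    ∀ (m : ℕ) (i : Fin n),
      (Q ^ m) (β i) = ∑ j, ((R (m + 1)) j i • β j - (R m) j i • U (β j)) := by
  have hQβ (j : Fin n) : Q (β j) = (2 : ℂ) • ∑ k, C k j • β k - U (β j) := by
    simp [hQ, hS, hC]
  have hQU (j : Fin n) : Q (U (β j)) = β j := by
    have h_inner (i : Fin n) : ⟪β i, β j⟫_ℂ = if i = j then 1 else 0 :=
      orthonormal_iff_ite.mp hβ i j
    simp only [hQ, LinearMap.neg_apply, LinearMap.comp_apply, hU_invol, hS, h_inner, ite_smul,
      one_smul, zero_smul, Finset.sum_ite_eq', Finset.mem_univ, if_true, two_smul]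
    abel
  have hR_rec (m : ℕ) : R (m + 2) = (2 : ℂ) • (C * R (m + 1)) - R m := by
    have h_two : ((m + 2 : ℕ) : ℤ) - 1 = m + 1 := by push_cast; ring
    have h_one : ((m + 1 : ℕ) : ℤ) - 1 = m := by push_cast; ring
    rw [hR, hR, hR, h_two, h_one, aeval_chebyshev_U_add_one]
  intro m i
  induction m with
  | zero => simp [hR, Matrix.one_apply]
  | succ m ih =>
    have h_swap : ∑ j, R (m + 1) j i • ∑ k, C k j • β k =
        ∑ k, (C * R (m + 1)) k i • β k := by
      simp only [Finset.smul_sum, Matrix.mul_apply, Finset.sum_smul, smul_smul]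
      rw [Finset.sum_comm]
      simp only [mul_comm]
    have h_first : ∑ j, R (m + 1) j i • (2 : ℂ) • ∑ k, C k j • β k =
        (2 : ℂ) • ∑ k, (C * R (m + 1)) k i • β k := by
      rw [← h_swap, Finset.smul_sum]
      exact Finset.sum_congr rfl fun j _ => smul_comm _ _ _
    rw [pow_succ', Module.End.mul_apply, ih, map_sum]
    simp only [map_sub, map_smul, hQβ, hQU, smul_sub, Finset.sum_sub_distrib, h_first, hR_rec,
      Matrix.sub_apply, Matrix.smul_apply, sub_smul, smul_assoc, ← Finset.smul_sum]
    abel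
end

section
/- Let H be a complex inner product space, let U : H → H be a linear isometric involution that is self-adjoint, and let β₁, …, βₙ be an orthonormal family in H. Define S := id − 2·∑ᵢ |βᵢ⟩⟨βᵢ| and Q := −S ∘ U, and let C be the n×n matrix with C_{ij} = ⟪βᵢ, U βⱼ⟫. Then for every natural number m and all indices i, j, the matrix element of the iterated operator satisfies ⟪βᵢ, Qᵐ(βⱼ)⟫ = (T_m(C))_{ij}, where T_m(C) is the Chebyshev polynomial of the first kind of degree m evaluated at the matrix C. -/
open scoped InnerProductSpace

section

variable {H : Type*} [NormedAddCommGroup H] [InnerProductSpace ℂ H] {n : ℕ} {β : Fin n → H}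

theorem reflection_apply_self (hβ : Orthonormal ℂ β) {S : H →ₗ[ℂ] H}
    (hS : ∀ x, S x = x - (2 : ℂ) • ∑ i, ⟪β i, x⟫_ℂ • β i) (j : Fin n) :
    S (β j) = -β j := by
  have h : ∑ i, ⟪β i, β j⟫_ℂ • β i = β j := by
    simp [orthonormal_iff_ite.mp hβ]
  rw [hS, h, two_smul]
  abel

theorem neg_reflection_comp_apply {U S : H →ₗ[ℂ] H}
    (hS : ∀ x, S x = x - (2 : ℂ) • ∑ i, ⟪β i, x⟫_ℂ • β i) (j : Fin n) :
    (-(S ∘ₗ U)) (β j) = (2 : ℂ) • ∑ k, ⟪β k, U (β j)⟫_ℂ • β k - U (β j) := by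
  rw [LinearMap.neg_apply, LinearMap.comp_apply, hS, neg_sub]

/-- On the span of `β`, the operator `Q = -S ∘ U` satisfies the three-term Chebyshev recurrence. -/
theorem neg_reflection_comp_pow_add_two_apply (hβ : Orthonormal ℂ β) {U S : H →ₗ[ℂ] H}
    (hU : ∀ x, U (U x) = x) (hS : ∀ x, S x = x - (2 : ℂ) • ∑ i, ⟪β i, x⟫_ℂ • β i)
    (m : ℕ) (j : Fin n) :
    ((-(S ∘ₗ U)) ^ (m + 2)) (β j) =
      (2 : ℂ) • ∑ k, ⟪β k, U (β j)⟫_ℂ • ((-(S ∘ₗ U)) ^ (m + 1)) (β k) -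
        ((-(S ∘ₗ U)) ^ m) (β j) := by
  have hQU : (-(S ∘ₗ U)) (U (β j)) = β j := by
    simp [hU, reflection_apply_self hβ hS]
  rw [pow_succ, Module.End.mul_apply, neg_reflection_comp_apply hS, map_sub, map_smul, map_sum]
  simp only [map_smul]
  congr 1
  rw [pow_succ, Module.End.mul_apply, hQU]

theorem inner_neg_reflection_comp_apply (hβ : Orthonormal ℂ β) {U S : H →ₗ[ℂ] H}
    (hS : ∀ x, S x = x - (2 : ℂ) • ∑ i, ⟪β i, x⟫_ℂ • β i) (i j : Fin n) :
    ⟪β i, (-(S ∘ₗ U)) (β j)⟫_ℂ = ⟪β i, U (β j)⟫_ℂ := by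
  rw [neg_reflection_comp_apply hS, inner_sub_right, inner_smul_right, hβ.inner_right_fintype]
  ring

end

/-- For the generalized Grover iteration `Q = -S ∘ U` built from a self-adjoint
isometric involution `U` and the reflection `S` about the span of an orthonormal family `β`,
the matrix elements of `Q^m` in the family `β` are given by the Chebyshev polynomial of the first
kind: `⟪β i, Q^m (β j)⟫ = (T_m(C))_{ij}` where `C_{ij} = ⟪β i, U (β j)⟫`. -/
theorem grover_matrix_elements_chebyshev_T
    {H : Type*} [NormedAddCommGroup H] [InnerProductSpace ℂ H]
    {n : ℕ} (β : Fin n → H) (hβ : Orthonormal ℂ β)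
    (U : H →ₗ[ℂ] H)
    (hU_invol : ∀ x, U (U x) = x)
    (hU_isom : ∀ x y, ⟪U x, U y⟫_ℂ = ⟪x, y⟫_ℂ)
    (hU_sa : ∀ x y, ⟪U x, y⟫_ℂ = ⟪x, U y⟫_ℂ)
    (S : H →ₗ[ℂ] H)
    (hS : ∀ x, S x = x - (2 : ℂ) • ∑ i, ⟪β i, x⟫_ℂ • β i)
    (Q : H →ₗ[ℂ] H) (hQ : Q = -(S ∘ₗ U))
    (C : Matrix (Fin n) (Fin n) ℂ) (hC : ∀ i j, C i j = ⟪β i, U (β j)⟫_ℂ) :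
    ∀ (m : ℕ) (i j : Fin n),
      ⟪β i, (Q ^ m) (β j)⟫_ℂ = (Polynomial.aeval C (Polynomial.Chebyshev.T ℂ (m : ℤ))) i j := by
  subst hQ
  intro m
  induction m using Nat.twoStepInduction with
  | zero =>
    intro i j
    simp [orthonormal_iff_ite.mp hβ, Matrix.one_apply]
  | one =>
    intro i j
    simpa [hC] using inner_neg_reflection_comp_apply hβ hS i j
  | more m ih₀ ih₁ =>
    intro i j
    have hT : Polynomial.aeval C (Polynomial.Chebyshev.T ℂ ((m + 2 : ℕ) : ℤ)) =
        (2 : ℂ) • (Polynomial.aeval C (Polynomial.Chebyshev.T ℂ ((m + 1 : ℕ) : ℤ)) * C) -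
          Polynomial.aeval C (Polynomial.Chebyshev.T ℂ (m : ℤ)) := by
      push_cast
      rw [Polynomial.Chebyshev.T_add_two, mul_assoc, mul_comm Polynomial.X]
      simp [two_mul, two_smul]
    rw [neg_reflection_comp_pow_add_two_apply hβ hU_invol hS, hT, Matrix.sub_apply,
      Matrix.smul_apply, Matrix.mul_apply, inner_sub_right, inner_smul_right, inner_sum,
      ih₀, smul_eq_mul]
    simp only [inner_smul_right, ih₁, hC, mul_comm]
end

section
/- Let N ≥ 1, f : Fin N → ZMod 2, and let U_f be the linear map on ℂ^{Fin N × ZMod 2} defined by U_f(e_{(x,b)}) = e_{(x, b + f(x))}. Let ρ := |{x : f(x) = 1}| / N be the weight of f. For a real parameter μ ∈ [0,1], define the unit vector v_μ := √μ · (1/√N) ∑_{x} |x,−⟩ + √(1−μ) · |0,+⟩, where |x,±⟩ := (e_{(x,0)} ± e_{(x,1)})/√2. Then ⟪v_μ, U_f v_μ⟫ = 1 − 2ρμ. -/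
open scoped InnerProductSpace

theorem EuclideanSpace.inner_single_one_single_one {ι : Type*} [Fintype ι] [DecidableEq ι]
    (i j : ι) : ⟪EuclideanSpace.single i (1 : ℂ), EuclideanSpace.single j (1 : ℂ)⟫_ℂ
      = if i = j then 1 else 0 := by
  simp [EuclideanSpace.inner_single_left]

/-- For the oracle `U_f` of a Boolean function `f` of weight `ρ = r/N`, and the
unit vector `v_μ = √μ (1/√N) ∑_x |x,−⟩ + √(1−μ) |0,+⟩`, the cosine is
`⟪v_μ, U_f v_μ⟫ = 1 − 2ρμ`. -/
theorem oracle_expectation_eq_one_sub_two_rho_mu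
    (N : ℕ) (hN : 1 ≤ N) (f : Fin N → ZMod 2)
    (Uf : EuclideanSpace ℂ (Fin N × ZMod 2) →ₗ[ℂ] EuclideanSpace ℂ (Fin N × ZMod 2))
    (hUf : ∀ (x : Fin N) (b : ZMod 2),
      Uf (EuclideanSpace.single (x, b) 1) = EuclideanSpace.single (x, b + f x) 1)
    (ρ : ℝ) (hρ : ρ = ((Finset.univ.filter fun x => f x = 1).card : ℝ) / N)
    (μ : ℝ) (hμ : μ ∈ Set.Icc (0 : ℝ) 1)
    (xplus xminus : Fin N → EuclideanSpace ℂ (Fin N × ZMod 2))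
    (hxplus : ∀ x, xplus x = ((Real.sqrt 2 : ℂ))⁻¹ •
      (EuclideanSpace.single (x, (0 : ZMod 2)) 1 + EuclideanSpace.single (x, (1 : ZMod 2)) 1))
    (hxminus : ∀ x, xminus x = ((Real.sqrt 2 : ℂ))⁻¹ •
      (EuclideanSpace.single (x, (0 : ZMod 2)) 1 - EuclideanSpace.single (x, (1 : ZMod 2)) 1))
    (v : EuclideanSpace ℂ (Fin N × ZMod 2))
    (hv : v = (Real.sqrt μ : ℂ) • (((Real.sqrt N : ℂ))⁻¹ • ∑ x, xminus x)
        + (Real.sqrt (1 - μ) : ℂ) • xplus ⟨0, hN⟩) :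
    ⟪v, Uf v⟫_ℂ = ((1 - 2 * ρ * μ : ℝ) : ℂ) := by
  have key : ∀ c : ZMod 2, c = 0 ∨ c = 1 := by decide
  have h11 : (1 : ZMod 2) + 1 = 0 := by decide
  have h2 : ((Real.sqrt 2 : ℂ))⁻¹ * ((Real.sqrt 2 : ℂ))⁻¹ = 1 / 2 := by
    rw [← mul_inv, ← Complex.ofReal_mul, Real.mul_self_sqrt (by norm_num)]
    norm_num
  have hNN : ((Real.sqrt N : ℂ))⁻¹ * ((Real.sqrt N : ℂ))⁻¹ = (N : ℂ)⁻¹ := by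
    rw [← mul_inv, ← Complex.ofReal_mul, Real.mul_self_sqrt (by positivity)]
    norm_num
  have hμμ : (Real.sqrt μ : ℂ) * (Real.sqrt μ : ℂ) = μ := by
    rw [← Complex.ofReal_mul, Real.mul_self_sqrt hμ.1]
  have hνν : (Real.sqrt (1 - μ) : ℂ) * (Real.sqrt (1 - μ) : ℂ) = 1 - μ := by
    rw [← Complex.ofReal_mul, Real.mul_self_sqrt (by linarith [hμ.2])]
    norm_num
  have hUplus : ∀ x, Uf (xplus x) = xplus x := by
    intro x
    rw [hxplus, map_smul, map_add, hUf, hUf]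
    rcases key (f x) with h | h
    · simp [h]
    · rw [h, h11, zero_add, add_comm]
  have hUminus : ∀ x, Uf (xminus x) = (if f x = 1 then (-1 : ℂ) else 1) • xminus x := by
    intro x
    rw [hxminus, map_smul, map_sub, hUf, hUf]
    rcases key (f x) with h | h
    · simp [h]
    · rw [h, h11, zero_add, if_pos rfl, smul_comm, neg_one_smul, neg_sub]
  have hmm : ∀ x y, ⟪xminus x, xminus y⟫_ℂ = if x = y then 1 else 0 := by
    intro x y
    rw [hxminus, hxminus, inner_smul_left, inner_smul_right, map_inv₀, Complex.conj_ofReal,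
      ← mul_assoc, h2]
    simp only [inner_sub_left, inner_sub_right, EuclideanSpace.inner_single_one_single_one,
      Prod.mk.injEq]
    by_cases h : x = y
    · norm_num [h]
    · simp [h]
  have hmp : ∀ x y, ⟪xminus x, xplus y⟫_ℂ = 0 := by
    intro x y
    rw [hxminus, hxplus, inner_smul_left, inner_smul_right]
    simp only [inner_sub_left, inner_add_right, EuclideanSpace.inner_single_one_single_one,
      Prod.mk.injEq]
    by_cases h : x = y <;> simp [h]
  have hpm : ∀ x y, ⟪xplus x, xminus y⟫_ℂ = 0 := fun x y => by
    rw [← inner_conj_symm, hmp, map_zero]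
  have hpp : ∀ x, ⟪xplus x, xplus x⟫_ℂ = 1 := by
    intro x
    rw [hxplus, inner_smul_left, inner_smul_right, map_inv₀, Complex.conj_ofReal,
      ← mul_assoc, h2]
    simp only [inner_add_left, inner_add_right, EuclideanSpace.inner_single_one_single_one,
      Prod.mk.injEq]
    norm_num
  have hsum : (∑ x, if f x = 1 then (-1 : ℂ) else 1)
      = N - 2 * ((Finset.univ.filter fun x => f x = 1).card : ℂ) := by
    have : ∀ x, (if f x = 1 then (-1 : ℂ) else 1) = 1 - 2 * (if f x = 1 then 1 else 0) := by
      intro x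
      split_ifs <;> norm_num
    simp only [this, Finset.sum_sub_distrib, ← Finset.mul_sum, Finset.sum_boole]
    simp
  have hSS : ⟪∑ x, xminus x, ∑ x, (if f x = 1 then (-1 : ℂ) else 1) • xminus x⟫_ℂ
      = N - 2 * ((Finset.univ.filter fun x => f x = 1).card : ℂ) := by
    rw [← hsum, sum_inner]
    refine Finset.sum_congr rfl fun x _ => ?_
    simp only [inner_sum, inner_smul_right, hmm, mul_ite, mul_one, mul_zero,
      Finset.sum_ite_eq, Finset.mem_univ, if_true]
  have hSp : ⟪∑ x, xminus x, xplus ⟨0, hN⟩⟫_ℂ = 0 := by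
    simp only [sum_inner, hmp, Finset.sum_const_zero]
  have hpS : ⟪xplus ⟨0, hN⟩, ∑ x, (if f x = 1 then (-1 : ℂ) else 1) • xminus x⟫_ℂ = 0 := by
    simp only [inner_sum, inner_smul_right, hpm, mul_zero, Finset.sum_const_zero]
  have hN0 : (N : ℂ) ≠ 0 := by exact_mod_cast (by omega : N ≠ 0)
  rw [hv]
  simp only [map_add, map_smul, map_sum, hUplus, hUminus]
  simp only [inner_add_left, inner_add_right, inner_smul_left, inner_smul_right, hSS, hSp, hpS,
    hpp, map_inv₀, Complex.conj_ofReal]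
  rw [hρ]
  push_cast
  generalize ((Finset.univ.filter fun x => f x = 1).card : ℂ) = r
  have hc : (N : ℂ)⁻¹ * N = 1 := inv_mul_cancel₀ hN0
  rw [div_eq_mul_inv]
  linear_combination (Real.sqrt μ : ℂ) * (Real.sqrt μ : ℂ) * (N - 2 * r) * hNN
    + (N : ℂ)⁻¹ * (N - 2 * r) * hμμ + hνν + μ * hc
end

section
/- Define m_min(ρ) := ⌈π / (2·arccos(1 − 2ρ))⌉ for ρ ∈ (0,1]. Then √ρ · m_min(ρ) tends to π/4 as ρ tends to 0 from the right; that is, the function ρ ↦ √ρ · ⌈π/(2·arccos(1−2ρ))⌉ has limit π/4 along the filter of right-neighborhoods of 0. -/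
open Real Filter

theorem arccos_one_sub_two_mul_sq {s : ℝ} (h0 : 0 ≤ s) (h1 : s ≤ 1) :
    arccos (1 - 2 * s ^ 2) = 2 * arcsin s := by
  have hcos : cos (2 * arcsin s) = 1 - 2 * s ^ 2 := by
    rw [cos_two_mul, cos_sq', sin_arcsin (by linarith) h1]
    ring
  rw [← hcos, arccos_cos]
  · linarith [arcsin_nonneg.2 h0]
  · linarith [arcsin_le_pi_div_two s]

theorem tendsto_arcsin_div_self_nhdsGT_zero :
    Tendsto (fun s : ℝ => arcsin s / s) (nhdsWithin 0 (Set.Ioi 0)) (nhds 1) := by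
  have h := (hasDerivAt_arcsin (x := 0) (by norm_num) (by norm_num)).tendsto_slope_zero_right
  simpa [div_eq_inv_mul] using h

theorem tendsto_sqrt_nhdsGT_zero :
    Tendsto Real.sqrt (nhdsWithin 0 (Set.Ioi 0)) (nhdsWithin 0 (Set.Ioi 0)) := by
  refine tendsto_nhdsWithin_iff.2 ⟨?_, ?_⟩
  · simpa using (continuous_sqrt.tendsto 0).mono_left nhdsWithin_le_nhds
  · filter_upwards [self_mem_nhdsWithin] with ρ hρ using sqrt_pos.2 hρ

theorem tendsto_mul_ceil_pi_div_arcsin :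
    Tendsto (fun s : ℝ => s * (⌈π / (4 * arcsin s)⌉₊ : ℝ))
      (nhdsWithin 0 (Set.Ioi 0)) (nhds (π / 4)) := by
  have hmul : Tendsto (fun s : ℝ => s * (π / (4 * arcsin s)))
      (nhdsWithin 0 (Set.Ioi 0)) (nhds (π / 4)) := by
    have h := (tendsto_arcsin_div_self_nhdsGT_zero.inv₀ one_ne_zero).const_mul (π / 4)
    rw [inv_one, mul_one] at h
    refine h.congr fun s => ?_
    rw [inv_div]
    ring
  have htop : Tendsto (fun s : ℝ => π / (4 * arcsin s)) (nhdsWithin 0 (Set.Ioi 0)) atTop := by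
    refine (hmul.pos_mul_atTop (by positivity) tendsto_inv_nhdsGT_zero).congr' ?_
    filter_upwards [self_mem_nhdsWithin] with s hs
    have : s ≠ 0 := ne_of_gt hs
    field_simp
  have h := hmul.mul ((tendsto_nat_ceil_div_atTop (R := ℝ)).comp htop)
  rw [mul_one] at h
  refine h.congr' ?_
  filter_upwards [htop.eventually_gt_atTop 0] with s hs
  rw [Function.comp_apply, mul_assoc, mul_div_cancel₀ _ hs.ne']

/-- Small-weight asymptotics of the minimum iteration number
`m_min(ρ) = ⌈π/(2 arccos(1 − 2ρ))⌉`: the function `ρ ↦ √ρ · m_min(ρ)` tends to `π/4` as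
`ρ → 0⁺`. -/
theorem min_iterations_asymptotics :
    Tendsto (fun ρ : ℝ => Real.sqrt ρ * (⌈π / (2 * Real.arccos (1 - 2 * ρ))⌉₊ : ℝ))
      (nhdsWithin 0 (Set.Ioi 0)) (nhds (π / 4)) := by
  refine (tendsto_mul_ceil_pi_div_arcsin.comp tendsto_sqrt_nhdsGT_zero).congr' ?_
  filter_upwards [Ioc_mem_nhdsGT (zero_lt_one (α := ℝ))] with ρ hρ
  have h := arccos_one_sub_two_mul_sq (sqrt_nonneg ρ) (sqrt_le_one.2 hρ.2)
  rw [sq_sqrt hρ.1.le] at h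
  rw [Function.comp_apply, h, ← mul_assoc]
  norm_num
end

section
/- Let H be a complex inner product space, and let U, V : H → H be two linear isometric involutions, each self-adjoint. Let β₁, …, βₙ be an orthonormal family in H, and define S := id − 2·∑ᵢ |βᵢ⟩⟨βᵢ|, Q_U := −S∘U, Q_V := −S∘V. Assume there are real numbers θᵢ, φᵢ ∈ (0,π) and real numbers γᵢ such that for all i, j: ⟪βᵢ, U βⱼ⟫ = δ_{ij} cos θᵢ, ⟪βᵢ, V βⱼ⟫ = δ_{ij} cos φᵢ, and ⟪βᵢ, U V βⱼ⟫ = δ_{ij} γᵢ. Then for β := ∑ᵢ cᵢ βᵢ with complex coefficients cᵢ and any natural number m, ⟪Q_Uᵐ β, Q_Vᵐ β⟫ = ∑ᵢ |cᵢ|² [ (sin((m+1)θᵢ)/sin θᵢ)(sin((m+1)φᵢ)/sin φᵢ) − (sin((m+1)θᵢ)/sin θᵢ)(sin(mφᵢ)/sin φᵢ)·cos φᵢ − (sin(mθᵢ)/sin θᵢ)(sin((m+1)φᵢ)/sin φᵢ)·cos θᵢ + (sin(mθᵢ)/sin θᵢ)(sin(mφᵢ)/sin φᵢ)·γᵢ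 ]. -/
open scoped InnerProductSpace
open Real

/-- If an involution `U` has a diagonal cosine matrix with respect to `β`, with entries `cos θᵢ`, then
the powers of the Grover iteration `-S U` act on `βᵢ` through Chebyshev polynomials of the second
kind evaluated at `cos θᵢ`. -/
theorem neg_reflection_comp_pow_apply
    {H : Type*} [NormedAddCommGroup H] [InnerProductSpace ℂ H]
    {ι : Type*} [Fintype ι] [DecidableEq ι] {β : ι → H} (hβ : Orthonormal ℂ β)
    {U S : H →ₗ[ℂ] H} (hU_invol : ∀ x, U (U x) = x)
    (hS : ∀ x, S x = x - (2 : ℂ) • ∑ i, ⟪β i, x⟫_ℂ • β i)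
    {θ : ι → ℝ} (hθ : ∀ i, Real.sin (θ i) ≠ 0)
    (hCU : ∀ i j, ⟪β i, U (β j)⟫_ℂ = if i = j then (Real.cos (θ i) : ℂ) else 0)
    (m : ℕ) (i : ι) :
    ((-(S ∘ₗ U)) ^ m) (β i) =
      ((Real.sin ((m + 1) * θ i) / Real.sin (θ i) : ℝ) : ℂ) • β i
        - ((Real.sin (m * θ i) / Real.sin (θ i) : ℝ) : ℂ) • U (β i) := by
  have hSβ : S (β i) = -β i := by
    simp only [hS, orthonormal_iff_ite.mp hβ, ite_smul, one_smul, zero_smul, Finset.sum_ite_eq',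
      Finset.mem_univ, if_true]
    module
  have hSU : S (U (β i)) = U (β i) - (2 * Real.cos (θ i) : ℂ) • β i := by
    simp only [hS, hCU, ite_smul, zero_smul, Finset.sum_ite_eq', Finset.mem_univ, if_true]
    module
  induction m with
  | zero => simp [hθ i]
  | succ k ih =>
    have hrec : Real.sin ((k + 1 + 1) * θ i) / Real.sin (θ i) =
        2 * Real.cos (θ i) * (Real.sin ((k + 1) * θ i) / Real.sin (θ i))
          - Real.sin (k * θ i) / Real.sin (θ i) := by
      have h₁ : (k + 1 + 1) * θ i = (k + 1) * θ i + θ i := by ring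
      have h₂ : k * θ i = (k + 1) * θ i - θ i := by ring
      rw [h₁, h₂, Real.sin_add, Real.sin_sub]
      ring
    rw [pow_succ', Module.End.mul_apply, ih]
    simp only [Nat.cast_succ]
    rw [hrec]
    simp only [LinearMap.neg_apply, LinearMap.comp_apply, map_sub, map_smul, hU_invol, hSβ, hSU]
    push_cast
    module

/-- Inner product of the final states of two generalized Grover iterations.
If the cosine matrices of the two self-adjoint isometric involutions `U`, `V` and of the product
`U V` with respect to the orthonormal family `β` are all diagonal, with diagonal entries
`cos θᵢ`, `cos φᵢ` and `γᵢ` respectively, then for `β = ∑ᵢ cᵢ βᵢ` and any `m`,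
`⟪Q_U^m β, Q_V^m β⟫` equals the stated sum over `i`. -/
theorem grover_final_states_inner_product
    {H : Type*} [NormedAddCommGroup H] [InnerProductSpace ℂ H]
    {n : ℕ} (β : Fin n → H) (hβ : Orthonormal ℂ β)
    (U V : H →ₗ[ℂ] H)
    (hU_invol : ∀ x, U (U x) = x) (hV_invol : ∀ x, V (V x) = x)
    (hU_isom : ∀ x y, ⟪U x, U y⟫_ℂ = ⟪x, y⟫_ℂ)
    (hV_isom : ∀ x y, ⟪V x, V y⟫_ℂ = ⟪x, y⟫_ℂ)
    (hU_sa : ∀ x y, ⟪U x, y⟫_ℂ = ⟪x, U y⟫_ℂ)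
    (hV_sa : ∀ x y, ⟪V x, y⟫_ℂ = ⟪x, V y⟫_ℂ)
    (S : H →ₗ[ℂ] H)
    (hS : ∀ x, S x = x - (2 : ℂ) • ∑ i, ⟪β i, x⟫_ℂ • β i)
    (QU QV : H →ₗ[ℂ] H) (hQU : QU = -(S ∘ₗ U)) (hQV : QV = -(S ∘ₗ V))
    (θ φ : Fin n → ℝ) (γ : Fin n → ℝ)
    (hθ : ∀ i, θ i ∈ Set.Ioo 0 π) (hφ : ∀ i, φ i ∈ Set.Ioo 0 π)
    (hCU : ∀ i j, ⟪β i, U (β j)⟫_ℂ = if i = j then (Real.cos (θ i) : ℂ) else 0)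
    (hCV : ∀ i j, ⟪β i, V (β j)⟫_ℂ = if i = j then (Real.cos (φ i) : ℂ) else 0)
    (hCUV : ∀ i j, ⟪β i, U (V (β j))⟫_ℂ = if i = j then (γ i : ℂ) else 0)
    (c : Fin n → ℂ) (b : H) (hb : b = ∑ i, c i • β i) (m : ℕ) :
    ⟪(QU ^ m) b, (QV ^ m) b⟫_ℂ =
      ∑ i, (‖c i‖ ^ 2 : ℝ) *
        (((Real.sin ((m + 1) * θ i) / Real.sin (θ i)) *
            (Real.sin ((m + 1) * φ i) / Real.sin (φ i))
          - (Real.sin ((m + 1) * θ i) / Real.sin (θ i)) *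
            (Real.sin (m * φ i) / Real.sin (φ i)) * Real.cos (φ i)
          - (Real.sin (m * θ i) / Real.sin (θ i)) *
            (Real.sin ((m + 1) * φ i) / Real.sin (φ i)) * Real.cos (θ i)
          + (Real.sin (m * θ i) / Real.sin (θ i)) *
            (Real.sin (m * φ i) / Real.sin (φ i)) * γ i : ℝ)) := by
  subst hb hQU hQV
  simp only [map_sum, map_smul,
    neg_reflection_comp_pow_apply hβ hU_invol hS (fun i => (Real.sin_pos_of_mem_Ioo (hθ i)).ne') hCU,
    neg_reflection_comp_pow_apply hβ hV_invol hS (fun i => (Real.sin_pos_of_mem_Ioo (hφ i)).ne') hCV,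
    sum_inner, inner_sum]
  rw [Complex.ofReal_sum]
  refine Finset.sum_congr rfl fun i _ => ?_
  simp only [inner_smul_left, inner_smul_right, inner_sub_left, inner_sub_right, hU_sa, hCU, hCV,
    hCUV, orthonormal_iff_ite.mp hβ, Complex.conj_ofReal]
  rw [Finset.sum_eq_single i (fun j _ hj => by simp [hj]) (by simp)]
  simp only [if_true]
  have hc : ((‖c i‖ ^ 2 : ℝ) : ℂ) = (starRingEnd ℂ) (c i) * c i := by
    rw [Complex.conj_mul']
    push_cast
    rfl
  rw [Complex.ofReal_mul, hc]
  push_cast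
  ring
end
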